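/- arXiv:1608.06555 — 2 statements merged into one kernel-verified Lean document; each statement's English description precedes it below -/
import Mathlib

section
/- For every ζ > 0 one has 2·G(ζ)^3·ζ^2 − 7·G(ζ)^2·ζ − 2·G(ζ)·ζ^2 + 6·G(ζ) + ζ > 0. Consequently the function θ ↦ G(1/θ) − θ is strictly convex on (0,∞), its second derivative in θ being ζ^2·(2G(ζ)^3ζ^2 − 7G(ζ)^2ζ − 2G(ζ)ζ^2 + 6G(ζ) + ζ) with ζ = 1/θ. -/
open MeasureTheory

noncomputable def besselK (n : ℕ) (ζ : ℝ) : ℝ :=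
  ∫ t in Set.Ioi (0 : ℝ), Real.cosh ((n : ℝ) * t) * Real.exp (-ζ * Real.cosh t)

noncomputable def Gfun (ζ : ℝ) : ℝ := besselK 2 ζ / besselK 1 ζ

open Filter Set Topology

lemma cosh_mul_exp_neg_mul_cosh_le {ζ : ℝ} (hζ : 0 < ζ) (n : ℕ) {t : ℝ} (ht : 0 ≤ t) :
    Real.cosh (n * t) * Real.exp (-ζ * Real.cosh t) ≤
      Real.exp ((n + 1) ^ 2 / ζ) * Real.exp (-t) := by
  have h₁ : Real.cosh (n * t) ≤ Real.exp (n * t) := by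
    have : Real.exp (-(n * t)) ≤ Real.exp (n * t) :=
      Real.exp_le_exp.2 (by linarith [mul_nonneg n.cast_nonneg ht])
    rw [Real.cosh_eq]
    linarith
  have h₂ : t ^ 2 / 4 ≤ Real.cosh t := by
    have := Real.quadratic_le_exp_of_nonneg ht
    rw [Real.cosh_eq]
    linarith [Real.exp_pos (-t)]
  have h₃ : (n + 1) * t ≤ (n + 1) ^ 2 / ζ + ζ * (t ^ 2 / 4) := by
    have : (n + 1) ^ 2 / ζ + ζ * (t ^ 2 / 4) - (n + 1) * t = ((n + 1) - ζ * t / 2) ^ 2 / ζ := by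
      field_simp
      ring
    have : 0 ≤ ((n + 1) - ζ * t / 2) ^ 2 / ζ := by positivity
    linarith
  calc Real.cosh (n * t) * Real.exp (-ζ * Real.cosh t)
      ≤ Real.exp (n * t) * Real.exp (-ζ * (t ^ 2 / 4)) := by
        gcongr ?_ * Real.exp ?_
        nlinarith
    _ ≤ Real.exp ((n + 1) ^ 2 / ζ) * Real.exp (-t) := by
        rw [← Real.exp_add, ← Real.exp_add]
        exact Real.exp_le_exp.2 (by linarith)

lemma integrableOn_besselK {ζ : ℝ} (hζ : 0 < ζ) (n : ℕ) :
    IntegrableOn (fun t => Real.cosh (n * t) * Real.exp (-ζ * Real.cosh t)) (Ioi 0) := by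
  refine Integrable.mono' ((integrableOn_exp_neg_Ioi 0).const_mul (Real.exp ((n + 1) ^ 2 / ζ)))
    (by fun_prop) ?_
  filter_upwards [ae_restrict_mem measurableSet_Ioi] with t ht
  rw [Real.norm_of_nonneg (by positivity)]
  exact cosh_mul_exp_neg_mul_cosh_le hζ n (le_of_lt ht)

lemma besselK_pos {ζ : ℝ} (hζ : 0 < ζ) (n : ℕ) : 0 < besselK n ζ := by
  refine (setIntegral_pos_iff_support_of_nonneg_ae
    (Eventually.of_forall fun t => by positivity) (integrableOn_besselK hζ n)).2 ?_
  have : Function.support (fun t => Real.cosh (n * t) * Real.exp (-ζ * Real.cosh t)) = univ :=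
    eq_univ_of_forall fun t => (by positivity : (0 : ℝ) < _).ne'
  rw [this]
  simp

lemma besselK_add_two {ζ : ℝ} (hζ : 0 < ζ) (n : ℕ) :
    besselK (n + 2) ζ = besselK n ζ + 2 * (n + 1) / ζ * besselK (n + 1) ζ := by
  have i₀ := integrableOn_besselK hζ n
  have i₁ := integrableOn_besselK hζ (n + 1)
  have i₂ := integrableOn_besselK hζ (n + 2)
  have i₃ : IntegrableOn (fun t => Real.cosh ((n + 2 : ℕ) * t) * Real.exp (-ζ * Real.cosh t) -
      Real.cosh (n * t) * Real.exp (-ζ * Real.cosh t)) (Ioi 0) := i₂.sub i₀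
  have hd : ∀ t ∈ Ici (0 : ℝ),
      HasDerivAt (fun t => Real.sinh ((n + 1 : ℕ) * t) * Real.exp (-ζ * Real.cosh t))
        ((n + 1) * (Real.cosh ((n + 1 : ℕ) * t) * Real.exp (-ζ * Real.cosh t)) -
          ζ / 2 * (Real.cosh ((n + 2 : ℕ) * t) * Real.exp (-ζ * Real.cosh t) -
            Real.cosh (n * t) * Real.exp (-ζ * Real.cosh t))) t := by
    intro t _
    have h := (((hasDerivAt_id t).const_mul ((n + 1 : ℕ) : ℝ)).sinh).mul
      (((Real.hasDerivAt_cosh t).const_mul (-ζ)).exp)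
    refine h.congr_deriv ?_
    have e₀ : (n : ℝ) * t = (n + 1) * t - t := by ring
    have e₂ : ((n : ℝ) + 2) * t = (n + 1) * t + t := by ring
    simp only [id]
    push_cast
    rw [e₀, e₂, Real.cosh_add, Real.cosh_sub]
    ring
  have hlim : Tendsto (fun t => Real.sinh ((n + 1 : ℕ) * t) * Real.exp (-ζ * Real.cosh t))
      atTop (𝓝 0) := by
    have hb : Tendsto (fun t => Real.exp (((n + 1 : ℕ) + 1) ^ 2 / ζ) * Real.exp (-t))
        atTop (𝓝 0) := by
      simpa using (Real.tendsto_exp_neg_atTop_nhds_zero).const_mul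
        (Real.exp (((n + 1 : ℕ) + 1) ^ 2 / ζ))
    refine tendsto_of_tendsto_of_tendsto_of_le_of_le' tendsto_const_nhds hb ?_ ?_
    · filter_upwards [eventually_ge_atTop 0] with t ht
      exact mul_nonneg (Real.sinh_nonneg_iff.2 (by positivity)) (Real.exp_pos _).le
    · filter_upwards [eventually_ge_atTop 0] with t ht
      refine le_trans ?_ (cosh_mul_exp_neg_mul_cosh_le hζ (n + 1) ht)
      gcongr
      exact (Real.sinh_lt_cosh _).le
  have hint := integral_Ioi_of_hasDerivAt_of_tendsto' hd
    ((i₁.const_mul _).sub (i₃.const_mul _)) hlim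
  rw [integral_sub (i₁.const_mul _) (i₃.const_mul _), integral_const_mul,
    integral_const_mul, integral_sub i₂ i₀] at hint
  simp only [mul_zero, Real.sinh_zero, zero_mul, sub_zero] at hint
  change (n + 1) * besselK (n + 1) ζ - ζ / 2 * (besselK (n + 2) ζ - besselK n ζ) = 0 at hint
  field_simp
  linarith

lemma hasDerivAt_besselK {ζ : ℝ} (hζ : 0 < ζ) (n : ℕ) :
    HasDerivAt (besselK (n + 1)) (-(besselK n ζ + besselK (n + 2) ζ) / 2) ζ := by
  have key : ∀ x t : ℝ, Real.cosh ((n + 1 : ℕ) * t) * (Real.cosh t * Real.exp (-x * Real.cosh t)) =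
      (Real.cosh (n * t) * Real.exp (-x * Real.cosh t) +
        Real.cosh ((n + 2 : ℕ) * t) * Real.exp (-x * Real.cosh t)) / 2 := by
    intro x t
    have e₀ : (n : ℝ) * t = (n + 1) * t - t := by ring
    have e₂ : ((n : ℝ) + 2) * t = (n + 1) * t + t := by ring
    push_cast
    rw [e₀, e₂, Real.cosh_add, Real.cosh_sub]
    ring
  have hint : ∀ x : ℝ, 0 < x → IntegrableOn (fun t =>
      Real.cosh ((n + 1 : ℕ) * t) * (Real.cosh t * Real.exp (-x * Real.cosh t))) (Ioi 0) := by
    intro x hx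
    simp only [key]
    exact ((integrableOn_besselK hx n).add (integrableOn_besselK hx (n + 2))).div_const 2
  have h := (hasDerivAt_integral_of_dominated_loc_of_deriv_le
    (μ := volume.restrict (Ioi (0 : ℝ))) (s := Ioi (ζ / 2)) (x₀ := ζ)
    (F := fun x t => Real.cosh ((n + 1 : ℕ) * t) * Real.exp (-x * Real.cosh t))
    (F' := fun x t => -(Real.cosh ((n + 1 : ℕ) * t) * (Real.cosh t * Real.exp (-x * Real.cosh t))))
    (bound := fun t =>
      Real.cosh ((n + 1 : ℕ) * t) * (Real.cosh t * Real.exp (-(ζ / 2) * Real.cosh t)))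
    (Ioi_mem_nhds (by linarith)) (Eventually.of_forall fun x => by fun_prop)
    (integrableOn_besselK hζ (n + 1)) (by fun_prop)
    (Eventually.of_forall fun t x hx => by
      rw [norm_neg, Real.norm_of_nonneg (by positivity)]
      have := Real.cosh_pos t
      gcongr
      exact le_of_lt hx)
    (hint _ (by positivity))
    (Eventually.of_forall fun t x _ => by
      have := ((((hasDerivAt_id x).neg).mul_const (Real.cosh t)).exp).const_mul
        (Real.cosh ((n + 1 : ℕ) * t))
      refine this.congr_deriv ?_
      simp only [id, Pi.neg_apply]
      ring)).2
  refine h.congr_deriv ?_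
  simp only [key]
  rw [integral_neg, integral_div,
    integral_add (integrableOn_besselK hζ n) (integrableOn_besselK hζ (n + 2))]
  simp only [besselK]
  ring

lemma besselK_two {ζ : ℝ} (hζ : 0 < ζ) : besselK 2 ζ = besselK 0 ζ + 2 / ζ * besselK 1 ζ := by
  simpa using besselK_add_two hζ 0

lemma hasDerivAt_besselK_one {ζ : ℝ} (hζ : 0 < ζ) :
    HasDerivAt (besselK 1) (-besselK 2 ζ + besselK 1 ζ / ζ) ζ := by
  refine (hasDerivAt_besselK hζ 0).congr_deriv ?_
  simp only [zero_add, besselK_two hζ]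
  field_simp
  ring

lemma hasDerivAt_besselK_two {ζ : ℝ} (hζ : 0 < ζ) :
    HasDerivAt (besselK 2) (-besselK 1 ζ - 2 * besselK 2 ζ / ζ) ζ := by
  refine (hasDerivAt_besselK hζ 1).congr_deriv ?_
  rw [besselK_add_two hζ 1]
  push_cast
  field_simp
  ring

lemma tendsto_id_mul_besselK (n : ℕ) :
    Tendsto (fun ζ => ζ * besselK n ζ) atTop (𝓝 0) := by
  have hb : Tendsto (fun ζ : ℝ => (Real.exp 1 * besselK n 1) * (ζ ^ 1 * Real.exp (-ζ)))
      atTop (𝓝 0) := by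
    simpa using (Real.tendsto_pow_mul_exp_neg_atTop_nhds_zero 1).const_mul
      (Real.exp 1 * besselK n 1)
  refine tendsto_of_tendsto_of_tendsto_of_le_of_le' tendsto_const_nhds hb ?_ ?_
  · filter_upwards [eventually_gt_atTop 0] with ζ hζ
    exact mul_nonneg hζ.le (besselK_pos hζ n).le
  · filter_upwards [eventually_ge_atTop 1] with ζ hζ
    have hle : besselK n ζ ≤ Real.exp (1 - ζ) * besselK n 1 := by
      unfold besselK
      rw [← integral_const_mul]
      refine setIntegral_mono (integrableOn_besselK (by linarith) n)
        ((integrableOn_besselK one_pos n).const_mul _) fun t => ?_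
      have : Real.exp (-ζ * Real.cosh t) ≤ Real.exp (1 - ζ) * Real.exp (-1 * Real.cosh t) := by
        rw [← Real.exp_add]
        gcongr
        nlinarith [Real.one_le_cosh t]
      calc _ ≤ Real.cosh (n * t) * (Real.exp (1 - ζ) * Real.exp (-1 * Real.cosh t)) := by gcongr
        _ = _ := by ring
    calc ζ * besselK n ζ ≤ ζ * (Real.exp (1 - ζ) * besselK n 1) := by gcongr
      _ = _ := by
        rw [sub_eq_add_neg, Real.exp_add]
        ring

lemma pos_of_hasDerivAt_neg_of_tendsto_zero {f f' : ℝ → ℝ}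
    (hf : ∀ x, 0 < x → HasDerivAt f (f' x) x) (hf' : ∀ x, 0 < x → f' x < 0)
    (hlim : Tendsto f atTop (𝓝 0)) {x : ℝ} (hx : 0 < x) : 0 < f x := by
  have hanti : StrictAntiOn f (Ioi 0) := by
    refine strictAntiOn_of_deriv_neg (convex_Ioi 0)
      (fun y hy => (hf y hy).continuousAt.continuousWithinAt) fun y hy => ?_
    rw [interior_Ioi] at hy
    rw [(hf y hy).deriv]
    exact hf' y hy
  have h₁ : f (x + 1) < f x := hanti hx (show 0 < x + 1 by linarith) (by linarith)
  have h₂ : 0 ≤ f (x + 1) := by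
    refine le_of_tendsto hlim ?_
    filter_upwards [eventually_ge_atTop (x + 1)] with y hy
    exact hanti.antitoneOn (show 0 < x + 1 by linarith) (show 0 < y by linarith) hy
  linarith

lemma two_mul_besselK_one_lt {ζ : ℝ} (hζ : 0 < ζ) : 2 * besselK 1 ζ < ζ * besselK 2 ζ := by
  have : ζ * besselK 2 ζ = ζ * besselK 0 ζ + 2 * besselK 1 ζ := by
    rw [besselK_two hζ]
    field_simp
  linarith [mul_pos hζ (besselK_pos hζ 0)]

/-- Equivalent to `ζ² < u² - 2u` for `u = ζ K₂(ζ) / K₁(ζ)`. -/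
lemma besselK_quadratic_pos {ζ : ℝ} (hζ : 0 < ζ) :
    0 < (ζ * besselK 2 ζ) ^ 2 - 2 * (ζ * besselK 2 ζ) * besselK 1 ζ - (ζ * besselK 1 ζ) ^ 2 := by
  refine pos_of_hasDerivAt_neg_of_tendsto_zero
    (f := fun ζ => (ζ * besselK 2 ζ) ^ 2 - 2 * (ζ * besselK 2 ζ) * besselK 1 ζ
      - (ζ * besselK 1 ζ) ^ 2)
    (f' := fun ζ => -2 * ζ * besselK 1 ζ ^ 2) ?_ ?_ ?_ hζ
  · intro x hx
    have ha := hasDerivAt_besselK_one hx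
    have hb := hasDerivAt_besselK_two hx
    have hxa := (hasDerivAt_id x).mul ha
    have hxb := (hasDerivAt_id x).mul hb
    refine (((hxb.pow 2).sub ((hxb.const_mul 2).mul ha)).sub (hxa.pow 2)).congr_deriv ?_
    simp only [id, Pi.mul_apply]
    push_cast
    field_simp
    ring
  · intro x hx
    have := besselK_pos hx 1
    have : 0 < x * besselK 1 x ^ 2 := by positivity
    linarith
  · have ha := tendsto_id_mul_besselK 1
    have hb := tendsto_id_mul_besselK 2
    have ha' : Tendsto (besselK 1) atTop (𝓝 0) := by
      have := tendsto_inv_atTop_zero.mul ha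
      rw [mul_zero] at this
      refine this.congr' ?_
      filter_upwards [eventually_gt_atTop 0] with x hx
      field_simp
    simpa using ((hb.pow 2).sub ((hb.const_mul 2).mul ha')).sub (ha.pow 2)

lemma besselK_rational_pos {ζ : ℝ} (hζ : 0 < ζ) :
    0 < besselK 2 ζ * (2 * (ζ * besselK 2 ζ) - 3 * besselK 1 ζ) *
      (ζ * besselK 2 ζ - 2 * besselK 1 ζ) / (2 * (ζ * besselK 2 ζ) - besselK 1 ζ)
      - ζ * besselK 1 ζ ^ 2 := by
  refine pos_of_hasDerivAt_neg_of_tendsto_zero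
    (f := fun ζ => besselK 2 ζ * (2 * (ζ * besselK 2 ζ) - 3 * besselK 1 ζ) *
      (ζ * besselK 2 ζ - 2 * besselK 1 ζ) / (2 * (ζ * besselK 2 ζ) - besselK 1 ζ)
      - ζ * besselK 1 ζ ^ 2)
    (f' := fun ζ => -(3 * ((ζ * besselK 2 ζ) ^ 2 - 2 * (ζ * besselK 2 ζ) * besselK 1 ζ
      - (ζ * besselK 1 ζ) ^ 2) * besselK 1 ζ ^ 2 /
        (ζ * (2 * (ζ * besselK 2 ζ) - besselK 1 ζ)) ^ 2)) ?_ ?_ ?_ hζ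
  · intro x hx
    have ha := hasDerivAt_besselK_one hx
    have hb := hasDerivAt_besselK_two hx
    have hxb := (hasDerivAt_id x).mul hb
    have hc : 2 * (x * besselK 2 x) - besselK 1 x ≠ 0 := by
      have := two_mul_besselK_one_lt hx
      have := besselK_pos hx 1
      exact ne_of_gt (by linarith)
    refine ((((hb.mul ((hxb.const_mul 2).sub (ha.const_mul 3))).mul
      (hxb.sub (ha.const_mul 2))).div ((hxb.const_mul 2).sub ha) hc).sub
      ((hasDerivAt_id x).mul (ha.pow 2))).congr_deriv ?_
    simp only [id, Pi.mul_apply, Pi.sub_apply, Pi.pow_apply]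
    generalize besselK 1 x = a at *
    generalize besselK 2 x = b at *
    obtain ⟨c, hc'⟩ : ∃ c, 2 * (x * b) - a = c := ⟨_, rfl⟩
    rw [hc'] at hc ⊢
    push_cast
    field_simp
    rw [← hc']
    ring
  · intro x hx
    have h₁ := besselK_quadratic_pos hx
    have h₂ := two_mul_besselK_one_lt hx
    have h₃ := besselK_pos hx 1
    have h₄ : 0 < 2 * (x * besselK 2 x) - besselK 1 x := by linarith
    exact neg_neg_of_pos (by positivity)
  · have hsq : ∀ n, Tendsto (fun ζ => ζ * besselK n ζ ^ 2) atTop (𝓝 0) := by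
      intro n
      have := tendsto_inv_atTop_zero.mul ((tendsto_id_mul_besselK n).pow 2)
      rw [zero_mul] at this
      refine this.congr' ?_
      filter_upwards [eventually_gt_atTop 0] with x hx
      field_simp
    rw [← sub_zero (0 : ℝ)]
    refine Tendsto.sub ?_ (hsq 1)
    refine tendsto_of_tendsto_of_tendsto_of_le_of_le' tendsto_const_nhds (hsq 2) ?_ ?_
    all_goals
      filter_upwards [eventually_gt_atTop 0] with x hx
      have h₂ := two_mul_besselK_one_lt hx
      have h₃ := besselK_pos hx 1
      have h₅ := besselK_pos hx 2
      have h₄ : 0 < 2 * (x * besselK 2 x) - besselK 1 x := by linarith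
      have h₆ : 0 < x * besselK 2 x - 2 * besselK 1 x := by linarith
      have h₇ : 0 < 2 * (x * besselK 2 x) - 3 * besselK 1 x := by linarith
    · positivity
    · rw [div_le_iff₀ h₄]
      calc besselK 2 x * (2 * (x * besselK 2 x) - 3 * besselK 1 x) *
            (x * besselK 2 x - 2 * besselK 1 x)
          ≤ besselK 2 x * (2 * (x * besselK 2 x) - besselK 1 x) * (x * besselK 2 x) := by
            gcongr <;> linarith
        _ = _ := by ring

lemma Gfun_cubic_pos {ζ : ℝ} (hζ : 0 < ζ) :
    0 < 2 * (Gfun ζ) ^ 3 * ζ ^ 2 - 7 * (Gfun ζ) ^ 2 * ζ - 2 * Gfun ζ * ζ ^ 2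
      + 6 * Gfun ζ + ζ := by
  have h₁ := besselK_rational_pos hζ
  have h₂ := two_mul_besselK_one_lt hζ
  have h₃ := besselK_pos hζ 1
  have h₄ : 0 < 2 * (ζ * besselK 2 ζ) - besselK 1 ζ := by linarith
  have h₅ := div_pos (mul_pos h₄ h₁) (pow_pos h₃ 3)
  refine h₅.trans_eq ?_
  rw [mul_sub, mul_div_cancel₀ _ h₄.ne']
  unfold Gfun
  field_simp
  ring

lemma hasDerivAt_Gfun {ζ : ℝ} (hζ : 0 < ζ) :
    HasDerivAt Gfun (Gfun ζ ^ 2 - 3 * Gfun ζ / ζ - 1) ζ := by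
  have h := besselK_pos hζ 1
  refine ((hasDerivAt_besselK_two hζ).div (hasDerivAt_besselK_one hζ) h.ne').congr_deriv ?_
  unfold Gfun
  field_simp
  ring

lemma hasDerivAt_Gfun_one_div_sub {θ : ℝ} (hθ : 0 < θ) :
    HasDerivAt (fun s : ℝ => Gfun (1 / s) - s)
      (-(1 / θ) ^ 2 * (Gfun (1 / θ) ^ 2 - 3 * Gfun (1 / θ) / (1 / θ) - 1) - 1) θ := by
  have hi : HasDerivAt (fun s : ℝ => 1 / s) (-(1 / θ) ^ 2) θ := by
    simpa using hasDerivAt_inv hθ.ne'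
  refine (((hasDerivAt_Gfun (one_div_pos.2 hθ)).comp θ hi).sub (hasDerivAt_id θ)).congr_deriv ?_
  ring

lemma deriv_deriv_Gfun_one_div_sub {θ : ℝ} (hθ : 0 < θ) :
    deriv (deriv (fun s : ℝ => Gfun (1 / s) - s)) θ =
      (1 / θ) ^ 2 * (2 * (Gfun (1 / θ)) ^ 3 * (1 / θ) ^ 2
        - 7 * (Gfun (1 / θ)) ^ 2 * (1 / θ)
        - 2 * Gfun (1 / θ) * (1 / θ) ^ 2 + 6 * Gfun (1 / θ) + 1 / θ) := by
  have heq : deriv (fun s : ℝ => Gfun (1 / s) - s) =ᶠ[𝓝 θ] fun s =>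
      -(1 / s) ^ 2 * (Gfun (1 / s) ^ 2 - 3 * Gfun (1 / s) / (1 / s) - 1) - 1 := by
    filter_upwards [Ioi_mem_nhds hθ] with s hs
    exact (hasDerivAt_Gfun_one_div_sub hs).deriv
  rw [heq.deriv_eq]
  have hi : HasDerivAt (fun s : ℝ => 1 / s) (-(1 / θ) ^ 2) θ := by
    simpa using hasDerivAt_inv hθ.ne'
  have hζ : 0 < 1 / θ := one_div_pos.2 hθ
  have hG : HasDerivAt (fun s : ℝ => Gfun (1 / s)) _ θ := (hasDerivAt_Gfun hζ).comp θ hi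
  have h := (((hi.pow 2).neg).mul (((hG.pow 2).sub ((hG.const_mul 3).div hi hζ.ne')).sub_const
    1)).sub_const 1
  refine (h.congr_deriv ?_).deriv
  simp only [Pi.pow_apply, Pi.neg_apply, Pi.sub_apply, Pi.div_apply]
  generalize Gfun (1 / θ) = g
  push_cast
  field_simp
  ring

theorem stmt4 :
    (∀ ζ : ℝ, 0 < ζ →
      0 < 2 * (Gfun ζ) ^ 3 * ζ ^ 2 - 7 * (Gfun ζ) ^ 2 * ζ - 2 * Gfun ζ * ζ ^ 2
        + 6 * Gfun ζ + ζ) ∧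
    StrictConvexOn ℝ (Set.Ioi 0) (fun θ : ℝ => Gfun (1 / θ) - θ) ∧
    ∀ θ : ℝ, 0 < θ →
      deriv (deriv (fun s : ℝ => Gfun (1 / s) - s)) θ =
        (1 / θ) ^ 2 * (2 * (Gfun (1 / θ)) ^ 3 * (1 / θ) ^ 2
          - 7 * (Gfun (1 / θ)) ^ 2 * (1 / θ)
          - 2 * Gfun (1 / θ) * (1 / θ) ^ 2 + 6 * Gfun (1 / θ) + 1 / θ) := by
  refine ⟨fun ζ hζ => Gfun_cubic_pos hζ, ?_, fun θ hθ => deriv_deriv_Gfun_one_div_sub hθ⟩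
  refine strictConvexOn_of_deriv2_pos (convex_Ioi 0)
    (fun θ hθ => (hasDerivAt_Gfun_one_div_sub hθ).continuousAt.continuousWithinAt) fun θ hθ => ?_
  rw [interior_Ioi] at hθ
  have hζ : 0 < 1 / θ := one_div_pos.2 hθ
  simp only [Function.iterate_succ, Function.iterate_zero, Function.comp_apply, id]
  rw [deriv_deriv_Gfun_one_div_sub hθ]
  exact mul_pos (pow_pos hζ 2) (Gfun_cubic_pos hζ)
end

section
/- For every n ≥ 1 and every 1 ≤ i ≤ n, the positive zero z_{i,n}(ζ) of Q_{2n}(·;ζ) is a differentiable, strictly decreasing function of ζ on (0,∞): ∂z_{i,n}/∂ζ < 0; correspondingly the negative zeros −z_{i,n}(ζ) are strictly increasing in ζ. -/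
open MeasureTheory Polynomial

noncomputable def wgt (ℓ : ℕ) (ζ x : ℝ) : ℝ :=
  (x ^ 2 - 1) ^ ((ℓ : ℝ) - 1 / 2) * Real.exp (-ζ * x) / besselK 1 ζ

/-- A linear functional that is positive on nonzero polynomials nonnegative on `(1, ∞)`. -/
def PosOnIoi (Λ : ℝ[X] →ₗ[ℝ] ℝ) : Prop :=
  ∀ p : ℝ[X], p ≠ 0 → (∀ x, 1 < x → 0 ≤ p.eval x) → 0 < Λ p

theorem map_C_mul_real (Λ : ℝ[X] →ₗ[ℝ] ℝ) (c : ℝ) (p : ℝ[X]) : Λ (C c * p) = c * Λ p := by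
  rw [← smul_eq_C_mul, map_smul, smul_eq_mul]

/-- Orthogonal polynomials have no zeros outside the open support interval. -/
theorem PosOnIoi.eval_ne_zero {Λ : ℝ[X] →ₗ[ℝ] ℝ} (hΛ : PosOnIoi Λ) {v p : ℝ[X]} {N : ℕ}
    (hv : v ≠ 0) (hv' : ∀ x, 1 < x → 0 ≤ v.eval x) (hp : p ≠ 0) (hN : p.natDegree ≤ N)
    (horth : ∀ q : ℝ[X], q.degree < N → Λ (v * p * q) = 0) {u : ℝ} (hu : u ≤ 1) :
    p.eval u ≠ 0 := by
  intro h0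
  obtain ⟨q, rfl⟩ := dvd_iff_isRoot.mpr h0
  have hq : q ≠ 0 := right_ne_zero_of_mul hp
  have hdeg : q.degree < N := by
    rw [natDegree_mul (X_sub_C_ne_zero u) hq, natDegree_X_sub_C] at hN
    rw [degree_eq_natDegree hq]
    exact_mod_cast (by omega : q.natDegree < N)
  have h1 := horth q hdeg
  refine (hΛ (v * ((X - C u) * q) * q) ?_ ?_).ne' h1
  · exact mul_ne_zero (mul_ne_zero hv hp) hq
  · intro x hx
    have h2 : 0 ≤ v.eval x * (x - u) * (q.eval x) ^ 2 :=
      mul_nonneg (mul_nonneg (hv' x hx) (by linarith)) (sq_nonneg _)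
    simp only [eval_mul, eval_sub, eval_X, eval_C]
    linarith

theorem eval_mul_eval_pos_of_ne_zero {p : ℝ[X]} {s : Set ℝ} (hs : IsPreconnected s)
    (hp : ∀ u ∈ s, p.eval u ≠ 0) {u w : ℝ} (hu : u ∈ s) (hw : w ∈ s) :
    0 < p.eval u * p.eval w := by
  by_contra! h
  have hc : ContinuousOn (fun x => p.eval x) s := p.continuous.continuousOn
  have h0 : (0 : ℝ) ∈ (fun x => p.eval x) '' s := by
    rcases mul_nonpos_iff.mp h with ⟨h1, h2⟩ | ⟨h1, h2⟩
    · exact hs.intermediate_value hw hu hc ⟨h2, h1⟩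
    · exact hs.intermediate_value hu hw hc ⟨h1, h2⟩
  obtain ⟨x, hx, hx0⟩ := h0
  exact hp x hx hx0

theorem eval_neg_of_odd_natDegree {p : ℝ[X]} (hodd : Odd p.natDegree) (hlc : 0 < p.leadingCoeff)
    (hp : ∀ u ≤ 1, p.eval u ≠ 0) {u : ℝ} (hu : u ≤ 1) : p.eval u < 0 := by
  have hnd : (p.comp (-X)).natDegree = p.natDegree := by
    rw [natDegree_comp, natDegree_neg, natDegree_X, mul_one]
  have hl : (p.comp (-X)).leadingCoeff = -p.leadingCoeff := by
    rw [leadingCoeff_comp (by simp), leadingCoeff_neg, leadingCoeff_X, hodd.neg_one_pow]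
    ring
  have ht := (p.comp (-X)).tendsto_atBot_of_leadingCoeff_nonpos
    (by rw [← natDegree_pos_iff_degree_pos, hnd]; exact hodd.pos) (by linarith)
  obtain ⟨x, hx1, hx2⟩ := ((ht.eventually (Filter.eventually_lt_atBot 0)).and
    (Filter.eventually_ge_atTop (-1))).exists
  have hx3 : p.eval (-x) < 0 := by simpa using hx1
  have := eval_mul_eval_pos_of_ne_zero isPreconnected_Iic (s := Set.Iic 1) hp hu
    (show -x ∈ Set.Iic (1 : ℝ) by simp only [Set.mem_Iic]; linarith)
  nlinarith

theorem degree_sub_coeff_lt {p q : ℝ[X]} {m : ℕ} (hp : p.natDegree = m)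
    (hq : q.degree < (m + 1 : ℕ)) :
    (C p.leadingCoeff * q - C (q.coeff m) * p).degree < m := by
  rw [degree_lt_iff_coeff_zero] at hq ⊢
  intro k hk
  rcases hk.eq_or_lt with rfl | hk
  · simp only [coeff_sub, coeff_C_mul, leadingCoeff, hp]; ring
  · simp only [coeff_sub, coeff_C_mul, hq k (by omega),
      coeff_eq_zero_of_natDegree_lt (show p.natDegree < k by omega)]
    ring

theorem orthogonal_of_degree_lt {Λ : ℝ[X] →ₗ[ℝ] ℝ} {v : ℝ[X]} {P : ℕ → ℝ[X]}
    (hdeg : ∀ n, (P n).natDegree = n) (hP : ∀ n, P n ≠ 0)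
    (horth : ∀ m n, m ≠ n → Λ (v * P m * P n) = 0) (N : ℕ) {q : ℝ[X]} (hq : q.degree < N) :
    Λ (v * P N * q) = 0 := by
  have key : ∀ m ≤ N, ∀ q : ℝ[X], q.degree < m → Λ (v * P N * q) = 0 := by
    intro m
    induction m with
    | zero =>
      intro _ q hq
      have : q = 0 := by
        rw [← degree_eq_bot]; exact Nat.WithBot.lt_zero_iff.mp (by exact_mod_cast hq)
      simp [this]
    | succ m ih =>
      intro hm q hq
      have h1 := ih (by omega) _ (degree_sub_coeff_lt (hdeg m) hq)
      have h2 : v * P N * (C (P m).leadingCoeff * q - C (q.coeff m) * P m) =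
        C (P m).leadingCoeff * (v * P N * q) - C (q.coeff m) * (v * P N * P m) := by ring
      rw [h2, map_sub, map_C_mul_real, map_C_mul_real, horth N m (by omega), mul_zero,
        sub_zero] at h1
      exact (mul_eq_zero.mp h1).resolve_left (leadingCoeff_ne_zero.mpr (hP m))
  exact key N le_rfl q hq

theorem leadingCoeff_mul_orthogonal {Λ : ℝ[X] →ₗ[ℝ] ℝ} {v p : ℝ[X]} {m : ℕ}
    (hp : p.natDegree = m) (horth : ∀ q : ℝ[X], q.degree < m → Λ (v * p * q) = 0) {q : ℝ[X]}
    (hq : q.degree < (m + 1 : ℕ)) :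
    p.leadingCoeff * Λ (v * p * q) = q.coeff m * Λ (v * p * p) := by
  have h1 := horth _ (degree_sub_coeff_lt hp hq)
  have h2 : v * p * (C p.leadingCoeff * q - C (q.coeff m) * p) =
    C p.leadingCoeff * (v * p * q) - C (q.coeff m) * (v * p * p) := by ring
  rw [h2, map_sub, map_C_mul_real, map_C_mul_real] at h1
  linarith

theorem exists_eq_sq_sub_sq_mul {p : ℝ[X]} {z : ℝ} {m : ℕ} (hz : 0 < z) (h1 : p.eval z = 0)
    (h2 : p.eval (-z) = 0) (hp : p.natDegree < m + 2) :
    ∃ q : ℝ[X], p = (X ^ 2 - C (z ^ 2)) * q ∧ q.degree < m := by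
  obtain ⟨q1, rfl⟩ := dvd_iff_isRoot.mpr h1
  have h3 : q1.IsRoot (-z) := by
    simp only [eval_mul, eval_sub, eval_X, eval_C, mul_eq_zero] at h2
    exact h2.resolve_left (by linarith)
  obtain ⟨q, rfl⟩ := dvd_iff_isRoot.mpr h3
  refine ⟨q, by simp only [map_neg, map_pow]; ring, ?_⟩
  by_cases hq : q = 0
  · simp [hq]
  · rw [natDegree_mul (X_sub_C_ne_zero _) (mul_ne_zero (X_sub_C_ne_zero _) hq),
      natDegree_mul (X_sub_C_ne_zero _) hq, natDegree_X_sub_C, natDegree_X_sub_C] at hp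
    rw [degree_eq_natDegree hq]
    exact_mod_cast (by omega : q.natDegree < m)

theorem coeff_sq_sub_sq_mul {q : ℝ[X]} {z : ℝ} {m : ℕ} (hq : q.degree < (m + 1 : ℕ)) :
    ((X ^ 2 - C (z ^ 2)) * q).coeff (m + 2) = q.coeff m := by
  rw [sub_mul, coeff_sub, coeff_X_pow_mul, coeff_C_mul,
    (degree_lt_iff_coeff_zero q _).mp hq (m + 2) (by omega), mul_zero, sub_zero]

theorem quadratic_form_pos {α β c₀ c₁ z : ℝ} (hc₁ : 0 < c₁) (hc : c₁ ≤ c₀) (hz : 1 < z)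
    (hneg : α * β < 0) (hbound : 0 < c₁ * β ^ 2 + c₀ * (1 + z) * (α * β)) :
    0 < c₀ * c₁ * ((z ^ 2 - 1) * α ^ 2 + β ^ 2) + z * (α * β) * (c₁ ^ 2 + c₀ ^ 2) := by
  have hα : α ≠ 0 := by rintro rfl; simp at hneg
  have hc₀ : 0 < c₀ := hc₁.trans_le hc
  have hα2 : 0 < α ^ 2 := by positivity
  obtain ⟨t, rfl⟩ : ∃ t, β = -(t * α) := ⟨-β / α, by field_simp⟩
  have ht : 0 < t := by
    have : α * -(t * α) = -(t * α ^ 2) := by ring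
    rw [this, neg_lt_zero] at hneg
    exact (pos_iff_pos_of_mul_pos hneg).mpr hα2
  obtain ⟨w, hw⟩ : ∃ w, w = c₁ * t - c₀ * (1 + z) := ⟨_, rfl⟩
  have hwpos : 0 < w := by
    have h1 : c₁ * (-(t * α)) ^ 2 + c₀ * (1 + z) * (α * -(t * α)) = (t * α ^ 2) * w := by
      rw [hw]; ring
    rw [h1] at hbound
    exact (pos_iff_pos_of_mul_pos hbound).mp (by positivity)
  have hsq : 0 ≤ (c₀ ^ 2 - c₁ ^ 2) * (z * w + c₀ * (z + 1)) :=
    mul_nonneg (by nlinarith) (by positivity)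
  have h2 : c₁ * (c₀ * c₁ * ((z ^ 2 - 1) * α ^ 2 + (-(t * α)) ^ 2)
      + z * (α * -(t * α)) * (c₁ ^ 2 + c₀ ^ 2)) =
      α ^ 2 * (c₀ * (w ^ 2 + 2 * w * c₀) + (c₀ ^ 2 - c₁ ^ 2) * (z * w + c₀ * (z + 1))) := by
    rw [hw]; ring
  have h3 : 0 < α ^ 2 * (c₀ * (w ^ 2 + 2 * w * c₀)
      + (c₀ ^ 2 - c₁ ^ 2) * (z * w + c₀ * (z + 1))) := by positivity
  rw [← h2] at h3
  exact (pos_iff_pos_of_mul_pos h3).mp hc₁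

theorem X_sq_sub_one_ne_zero : (X ^ 2 - 1 : ℝ[X]) ≠ 0 := by
  intro h
  have := congrArg (eval 0) h
  norm_num at this

theorem eval_X_sq_sub_one_nonneg (x : ℝ) (hx : 1 < x) : 0 ≤ (X ^ 2 - 1 : ℝ[X]).eval x := by
  simp only [eval_sub, eval_pow, eval_X, eval_one]
  nlinarith

section

variable {Λ : ℝ[X] →ₗ[ℝ] ℝ} {n : ℕ} {P0 P1 : ℝ[X]}

theorem leadingCoeff_le_of_orthogonal (hΛ : PosOnIoi Λ)
    (hd0 : P0.natDegree = n + 1) (hd1 : P1.natDegree = n)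
    (hc0 : 0 < P0.leadingCoeff) (hc1 : 0 < P1.leadingCoeff)
    (ho0 : ∀ q : ℝ[X], q.degree < (n + 1 : ℕ) → Λ (1 * P0 * q) = 0)
    (hK : Λ (1 * P0 * P0) = Λ ((X ^ 2 - 1) * P1 * P1)) :
    P1.leadingCoeff ≤ P0.leadingCoeff := by
  have hP0 : P0 ≠ 0 := leadingCoeff_ne_zero.mp hc0.ne'
  have hP1 : P1 ≠ 0 := leadingCoeff_ne_zero.mp hc1.ne'
  have hX1 : (X - 1 : ℝ[X]) ≠ 0 := by simpa using X_sub_C_ne_zero (1 : ℝ)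
  have hKpos : 0 < Λ (1 * P0 * P0) := by
    refine hΛ _ (by simpa using hP0) fun x _ => ?_
    simp only [eval_mul, one_mul]
    exact mul_self_nonneg _
  have hdeg : ((X - 1) * P1).natDegree = n + 1 := by
    rw [natDegree_mul hX1 hP1, hd1, show (X - 1 : ℝ[X]) = X - C 1 by simp, natDegree_X_sub_C]
    ring
  have hcoeff : ((X - 1) * P1).coeff (n + 1) = P1.leadingCoeff := by
    rw [← hdeg, coeff_natDegree, leadingCoeff_mul, show (X - 1 : ℝ[X]) = X - C 1 by simp,
      leadingCoeff_X_sub_C, one_mul]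
  have h1 := leadingCoeff_mul_orthogonal (q := (X - 1) * P1) hd0 ho0 (by
    rw [degree_eq_natDegree (mul_ne_zero hX1 hP1), hdeg]; exact_mod_cast (by omega))
  rw [hcoeff] at h1
  have h2 : Λ ((X - 1) * P1 * ((X - 1) * P1)) < Λ ((X ^ 2 - 1) * P1 * P1) := by
    have := hΛ (C 2 * (X - 1) * P1 * P1)
      (mul_ne_zero (mul_ne_zero (mul_ne_zero (by simp) hX1) hP1) hP1) (fun x hx => by
        simp only [eval_mul, eval_sub, eval_X, eval_C, eval_one]
        have := mul_nonneg (sub_nonneg.mpr hx.le) (mul_self_nonneg (P1.eval x))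
        linarith)
    rw [show C 2 * (X - 1) * P1 * P1 = (X ^ 2 - 1) * P1 * P1 - (X - 1) * P1 * ((X - 1) * P1) by
      simp only [map_ofNat]; ring, map_sub] at this
    linarith
  have hnn : ∀ p : ℝ[X], 0 ≤ Λ (p * p) := by
    intro p
    by_cases hp : p = 0
    · simp [hp]
    · exact (hΛ _ (mul_ne_zero hp hp) fun x _ => by
        rw [eval_mul]; exact mul_self_nonneg _).le
  have h3 := hnn (C P0.leadingCoeff * ((X - 1) * P1) - C P1.leadingCoeff * P0)
  have h4 : (C P0.leadingCoeff * ((X - 1) * P1) - C P1.leadingCoeff * P0) *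
      (C P0.leadingCoeff * ((X - 1) * P1) - C P1.leadingCoeff * P0) =
      C P0.leadingCoeff * (C P0.leadingCoeff * ((X - 1) * P1 * ((X - 1) * P1)))
      - C 2 * (C P1.leadingCoeff * (C P0.leadingCoeff * (1 * P0 * ((X - 1) * P1))))
      + C P1.leadingCoeff * (C P1.leadingCoeff * (1 * P0 * P0)) := by
    simp only [map_ofNat]; ring
  rw [h4, map_add, map_sub] at h3
  simp only [map_C_mul_real] at h3
  rw [h1] at h3
  have hsq : P1.leadingCoeff ^ 2 * Λ (1 * P0 * P0) ≤ P0.leadingCoeff ^ 2 * Λ (1 * P0 * P0) := by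
    rw [← hK] at h2
    nlinarith [mul_lt_mul_of_pos_left h2 (pow_pos hc0 2)]
  exact (sq_le_sq₀ hc1.le hc0.le).mp (le_of_mul_le_mul_right hsq hKpos)

theorem eval_mul_eval_neg_of_orthogonal (hΛ : PosOnIoi Λ)
    (hd0 : P0.natDegree = n + 1) (hd1 : P1.natDegree = n)
    (hc0 : 0 < P0.leadingCoeff) (hc1 : 0 < P1.leadingCoeff)
    (ho0 : ∀ q : ℝ[X], q.degree < (n + 1 : ℕ) → Λ (1 * P0 * q) = 0)
    (ho1 : ∀ q : ℝ[X], q.degree < n → Λ ((X ^ 2 - 1) * P1 * q) = 0) {u : ℝ} (hu : u ≤ 1) :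
    P1.eval u * P0.eval u < 0 := by
  have hP0 : P0 ≠ 0 := leadingCoeff_ne_zero.mp hc0.ne'
  have hP1 : P1 ≠ 0 := leadingCoeff_ne_zero.mp hc1.ne'
  have h0 : ∀ u ≤ 1, P0.eval u ≠ 0 := fun u hu =>
    hΛ.eval_ne_zero one_ne_zero (fun x _ => by simp) hP0 hd0.le ho0 hu
  have h1 : ∀ u ≤ 1, P1.eval u ≠ 0 := fun u hu =>
    hΛ.eval_ne_zero X_sq_sub_one_ne_zero eval_X_sq_sub_one_nonneg hP1 hd1.le ho1 hu
  rw [← eval_mul]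
  refine eval_neg_of_odd_natDegree ?_ ?_ (fun u hu => ?_) hu
  · rw [natDegree_mul hP1 hP0, hd0, hd1]
    exact ⟨n, by ring⟩
  · rw [leadingCoeff_mul]; positivity
  · rw [eval_mul]; exact mul_ne_zero (h1 u hu) (h0 u hu)

theorem eval_bound_of_orthogonal (hΛ : PosOnIoi Λ)
    (hd0 : P0.natDegree = n + 1) (hd1 : P1.natDegree = n)
    (hc0 : 0 < P0.leadingCoeff) (hc1 : 0 < P1.leadingCoeff)
    (ho0 : ∀ q : ℝ[X], q.degree < (n + 1 : ℕ) → Λ (1 * P0 * q) = 0)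
    (ho1 : ∀ q : ℝ[X], q.degree < n → Λ ((X ^ 2 - 1) * P1 * q) = 0) {u : ℝ} (hu : u ≤ 1) :
    0 < P1.leadingCoeff * P0.eval u ^ 2 +
      P0.leadingCoeff * (1 - u) * (P1.eval u * P0.eval u) := by
  have hP0 : P0 ≠ 0 := leadingCoeff_ne_zero.mp hc0.ne'
  have h0 : ∀ u ∈ Set.Iic (1 : ℝ), P0.eval u ≠ 0 := fun u hu =>
    hΛ.eval_ne_zero one_ne_zero (fun x _ => by simp) hP0 hd0.le ho0 hu
  obtain ⟨D, hD⟩ : ∃ D, D = C P1.leadingCoeff * P0 - C P0.leadingCoeff * ((X - 1) * P1) :=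
    ⟨_, rfl⟩
  have hDeval : ∀ x, D.eval x =
      P1.leadingCoeff * P0.eval x + P0.leadingCoeff * (1 - x) * P1.eval x := by
    intro x
    simp only [hD, eval_sub, eval_mul, eval_C, eval_X, eval_one]
    ring
  have hD1 : D.eval 1 = P1.leadingCoeff * P0.eval 1 := by rw [hDeval]; ring
  have hDne : D ≠ 0 := by
    rintro h
    rw [h, eval_zero] at hD1
    exact mul_ne_zero hc1.ne' (h0 1 (by simp)) hD1.symm
  have hDdeg : D.natDegree ≤ n := by
    rw [natDegree_le_iff_coeff_eq_zero]
    intro k hk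
    obtain ⟨k, rfl⟩ : ∃ j, k = j + 1 := ⟨k - 1, by omega⟩
    rw [hD, sub_mul, one_mul, coeff_sub, coeff_C_mul, coeff_C_mul, coeff_sub, coeff_X_mul,
      coeff_eq_zero_of_natDegree_lt (show P1.natDegree < k + 1 by omega)]
    rcases (show n ≤ k by omega).eq_or_lt with rfl | h
    · rw [leadingCoeff, leadingCoeff, hd0, hd1]; ring
    · rw [coeff_eq_zero_of_natDegree_lt (show P1.natDegree < k by omega),
        coeff_eq_zero_of_natDegree_lt (show P0.natDegree < k + 1 by omega)]
      ring
  have hDo : ∀ q : ℝ[X], q.degree < n → Λ ((X + 1) * D * q) = 0 := by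
    intro q hq
    have h1 : (X + 1) * D * q = C P1.leadingCoeff * (1 * P0 * ((X + 1) * q))
        - C P0.leadingCoeff * ((X ^ 2 - 1) * P1 * q) := by rw [hD]; ring
    rw [h1, map_sub, map_C_mul_real, map_C_mul_real, ho1 q hq, ho0, mul_zero, mul_zero, sub_zero]
    rw [degree_lt_iff_coeff_zero] at hq ⊢
    intro k hk
    obtain ⟨k, rfl⟩ : ∃ j, k = j + 1 := ⟨k - 1, by omega⟩
    rw [add_mul, one_mul, coeff_add, coeff_X_mul, hq _ (by omega), hq _ (by omega), add_zero]
  have hX1 : (X + 1 : ℝ[X]) ≠ 0 := by simpa using X_add_C_ne_zero (1 : ℝ)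
  have hDnz : ∀ u ∈ Set.Iic (1 : ℝ), D.eval u ≠ 0 := fun u hu =>
    hΛ.eval_ne_zero hX1 (fun x hx => by simp; linarith) hDne hDdeg hDo hu
  have h1 := eval_mul_eval_pos_of_ne_zero isPreconnected_Iic hDnz hu (show (1 : ℝ) ∈ _ by simp)
  have h2 := eval_mul_eval_pos_of_ne_zero isPreconnected_Iic h0 hu (show (1 : ℝ) ∈ _ by simp)
  have h3 : 0 < D.eval u * P0.eval u := by
    rw [hD1] at h1
    have h4 := mul_pos h1 h2
    have h5 : D.eval u * (P1.leadingCoeff * P0.eval 1) * (P0.eval u * P0.eval 1) =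
        (P1.leadingCoeff * P0.eval 1 ^ 2) * (D.eval u * P0.eval u) := by ring
    rw [h5] at h4
    exact (pos_iff_pos_of_mul_pos h4).mp (mul_pos hc1 (by positivity [h0 1 (by simp)]))
  rw [hDeval] at h3
  linarith

end

theorem degree_mul_left_lt {p q : ℝ[X]} {k m : ℕ} (hp : p.natDegree ≤ k) (hq : q.degree < m) :
    (p * q).degree < (k + m : ℕ) := by
  by_cases h : p * q = 0
  · simp [h]
  · have hq0 := right_ne_zero_of_mul h
    rw [degree_eq_natDegree hq0] at hq
    rw [degree_eq_natDegree h, natDegree_mul (left_ne_zero_of_mul h) hq0]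
    have : q.natDegree < m := by exact_mod_cast hq
    exact_mod_cast (by omega)

/-- The division step: if `(e, h)` satisfies the two vanishing conditions at `±z`, then
`e + sinh θ · h` is divisible by the linear form vanishing at `cosh θ = ±z`. -/
theorem exists_division {n : ℕ} {e h : ℝ[X]} {z : ℝ} (hz : 1 < z)
    (he : e.natDegree ≤ n + 1) (hh : h.natDegree ≤ n)
    (h1 : e.eval z + h.eval z = 0) (h2 : e.eval (-z) = h.eval (-z)) :
    ∃ A B : ℝ[X], A.degree < (n + 1 : ℕ) ∧ B.degree < n ∧
      e = C (z ^ 2) * ((X ^ 2 - 1) * B) - C z * (X * A) ∧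
      h = C (z ^ 2) * A - C (z * (z ^ 2 - 1)) * (X * B) ∧
      z * A.coeff n = (z ^ 2 - 1) * e.coeff (n + 1) + z * h.coeff n ∧
      (1 ≤ n → z * B.coeff (n - 1) = z * e.coeff (n + 1) + h.coeff n) := by
  have hz0 : 0 < z := by linarith
  have hXh : (X * h).natDegree ≤ n + 1 := natDegree_mul_le.trans (by simp; omega)
  have hXe : (X * e).natDegree ≤ n + 2 := natDegree_mul_le.trans (by simp; omega)
  have hX2 : ((X ^ 2 - 1) * h).natDegree ≤ n + 2 := by
    rw [show (X ^ 2 - 1 : ℝ[X]) = X ^ 2 - C 1 by simp]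
    exact natDegree_mul_le.trans (by rw [natDegree_X_pow_sub_C]; omega)
  obtain ⟨A, hA, hAd⟩ := exists_eq_sq_sub_sq_mul (m := n + 1)
    (p := C ((z ^ 2 - 1) / z) * (X * e) + (X ^ 2 - 1) * h) hz0
    (by
      simp only [eval_add, eval_mul, eval_C, eval_X, eval_sub, eval_pow, eval_one]
      rw [eq_neg_of_add_eq_zero_left h1]; field_simp; ring)
    (by
      simp only [eval_add, eval_mul, eval_C, eval_X, eval_sub, eval_pow, eval_one]
      rw [h2]; field_simp; ring)
    (by
      refine Nat.lt_succ_of_le (natDegree_add_le_of_degree_le ?_ hX2)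
      exact (natDegree_C_mul_le _ _).trans hXe)
  obtain ⟨B, hB, hBd⟩ := exists_eq_sq_sub_sq_mul (m := n) (p := e + C (1 / z) * (X * h)) hz0
    (by
      simp only [eval_add, eval_mul, eval_C, eval_X]
      rw [eq_neg_of_add_eq_zero_left h1]; field_simp; ring)
    (by
      simp only [eval_add, eval_mul, eval_C, eval_X]
      rw [h2]; field_simp; ring)
    (by
      refine Nat.lt_succ_of_le (natDegree_add_le_of_degree_le he ?_)
      exact (natDegree_C_mul_le _ _).trans hXh)
  have hne : (X ^ 2 - C (z ^ 2) : ℝ[X]) ≠ 0 := X_pow_sub_C_ne_zero (by norm_num) _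
  have hCz : (C z * C (1 / z) : ℝ[X]) = 1 := by
    rw [← C_mul, mul_one_div_cancel hz0.ne', C_1]
  have hC2 : (C z * C ((z ^ 2 - 1) / z) : ℝ[X]) = C z ^ 2 - 1 := by
    rw [← C_mul, mul_div_cancel₀ _ hz0.ne']; simp
  refine ⟨A, B, hAd, hBd, ?_, ?_, ?_, ?_⟩
  · apply mul_left_cancel₀ hne
    rw [show (X ^ 2 - C (z ^ 2)) * (C (z ^ 2) * ((X ^ 2 - 1) * B) - C z * (X * A)) =
      C (z ^ 2) * ((X ^ 2 - 1) * ((X ^ 2 - C (z ^ 2)) * B))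
        - C z * (X * ((X ^ 2 - C (z ^ 2)) * A)) by ring, ← hA, ← hB]
    simp only [C_pow]
    linear_combination (-(C z * (X ^ 2 - 1) * X * h)) * hCz + (X ^ 2 * e) * hC2
  · apply mul_left_cancel₀ hne
    rw [show (X ^ 2 - C (z ^ 2)) * (C (z ^ 2) * A - C (z * (z ^ 2 - 1)) * (X * B)) =
      C (z ^ 2) * ((X ^ 2 - C (z ^ 2)) * A)
        - C (z * (z ^ 2 - 1)) * (X * ((X ^ 2 - C (z ^ 2)) * B)) by ring, ← hA, ← hB]
    simp only [C_pow, C_mul, C_sub, C_1]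
    linear_combination (-(C z * X * e)) * hC2 + ((C z ^ 2 - 1) * X ^ 2 * h) * hCz
  · have h3 := coeff_sq_sub_sq_mul (z := z) hAd
    rw [← hA] at h3
    simp only [coeff_add, coeff_C_mul, coeff_X_mul, sub_mul, one_mul, coeff_sub,
      coeff_X_pow_mul] at h3
    rw [coeff_eq_zero_of_natDegree_lt (show h.natDegree < n + 2 by omega)] at h3
    rw [← h3]; field_simp; ring
  · intro hn
    obtain ⟨m, rfl⟩ : ∃ m, n = m + 1 := ⟨n - 1, by omega⟩
    have h3 := congrArg (fun p => p.coeff (m + 2)) hB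
    simp only [coeff_sq_sub_sq_mul hBd, coeff_add, coeff_C_mul, coeff_X_mul] at h3
    rw [Nat.add_sub_cancel, ← h3]; field_simp

set_option maxHeartbeats 1000000 in
/-- Algebraic core: the velocity of a zero is negative. Here `R0`, `R1` are the derivatives of
`P0`, `P1` with respect to the parameter and `d` is the velocity of the zero `z`. -/
theorem zero_velocity_neg {Λ : ℝ[X] →ₗ[ℝ] ℝ} (hΛ : PosOnIoi Λ) {n : ℕ} (hn : 1 ≤ n)
    {P0 P1 R0 R1 : ℝ[X]}
    (hd0 : P0.natDegree = n + 1) (hd1 : P1.natDegree = n)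
    (hc0 : 0 < P0.leadingCoeff) (hc1 : 0 < P1.leadingCoeff)
    (ho0 : ∀ q : ℝ[X], q.degree < (n + 1 : ℕ) → Λ (1 * P0 * q) = 0)
    (ho1 : ∀ q : ℝ[X], q.degree < n → Λ ((X ^ 2 - 1) * P1 * q) = 0)
    (hK : Λ (1 * P0 * P0) = Λ ((X ^ 2 - 1) * P1 * P1))
    (hR0d : R0.natDegree ≤ n + 1) (hR1d : R1.natDegree ≤ n)
    (hR0 : ∀ q : ℝ[X], q.degree < (n + 1 : ℕ) → Λ (1 * R0 * q) = Λ (X * (1 * P0 * q)))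
    (hR1 : ∀ q : ℝ[X], q.degree < n →
      Λ ((X ^ 2 - 1) * R1 * q) = Λ (X * ((X ^ 2 - 1) * P1 * q)))
    {z d : ℝ} (hz : 1 < z)
    (hQ : P0.eval z * P1.eval (-z) + P0.eval (-z) * P1.eval z = 0)
    (hd : (R0.eval z + d * (derivative P0).eval z) * P1.eval (-z)
        + P0.eval z * (R1.eval (-z) - d * (derivative P1).eval (-z))
        + ((R0.eval (-z) - d * (derivative P0).eval (-z)) * P1.eval z
        + P0.eval (-z) * (R1.eval z + d * (derivative P1).eval z)) = 0) :
    d < 0 := by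
  have hz0 : 0 < z := by linarith
  have hσ : 0 < z ^ 2 - 1 := by nlinarith
  have hP0 : P0 ≠ 0 := leadingCoeff_ne_zero.mp hc0.ne'
  obtain ⟨α, hα⟩ : ∃ α, α = P1.eval (-z) := ⟨_, rfl⟩
  obtain ⟨β, hβ⟩ : ∃ β, β = P0.eval (-z) := ⟨_, rfl⟩
  obtain ⟨α', hα'⟩ : ∃ α', α' = R1.eval (-z) - d * (derivative P1).eval (-z) := ⟨_, rfl⟩
  obtain ⟨β', hβ'⟩ : ∃ β', β' = R0.eval (-z) - d * (derivative P0).eval (-z) := ⟨_, rfl⟩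
  have hneg := eval_mul_eval_neg_of_orthogonal hΛ hd0 hd1 hc0 hc1 ho0 ho1
    (show -z ≤ 1 by linarith)
  have hbound := eval_bound_of_orthogonal hΛ hd0 hd1 hc0 hc1 ho0 ho1 (show -z ≤ 1 by linarith)
  have hle := leadingCoeff_le_of_orthogonal hΛ hd0 hd1 hc0 hc1 ho0 hK
  rw [← hα, ← hβ] at hneg hbound hQ
  rw [sub_neg_eq_add] at hbound
  rw [← hα, ← hβ, ← hα', ← hβ'] at hd
  have hquad := quadratic_form_pos hc1 hle hz hneg hbound
  have hα0 : α ≠ 0 := by rintro rfl; simp at hneg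
  -- the eigenvector and its image
  have had : (C α * P0).natDegree ≤ n + 1 := (natDegree_C_mul_le _ _).trans hd0.le
  have hbd : (C β * P1).natDegree ≤ n := (natDegree_C_mul_le _ _).trans hd1.le
  obtain ⟨A, B, hAd, hBd, ha, hb, hAc, hBc⟩ := exists_division (e := C α * P0) (h := C β * P1)
    hz had hbd (by simp only [eval_mul, eval_C]; linarith)
    (by simp only [eval_mul, eval_C, ← hα, ← hβ]; ring)
  have hp0c : P0.coeff (n + 1) = P0.leadingCoeff := by rw [leadingCoeff, hd0]
  have hp1c : P1.coeff n = P1.leadingCoeff := by rw [leadingCoeff, hd1]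
  replace hBc := hBc hn
  rw [coeff_C_mul, coeff_C_mul, hp0c, hp1c] at hAc hBc
  -- orthogonality in terms of `A`, `B`
  have hoa : ∀ q : ℝ[X], q.degree < (n + 1 : ℕ) →
      z * Λ ((X ^ 2 - 1) * B * q) = Λ (X * A * q) := by
    intro q hq
    have h1 : α * Λ (1 * P0 * q) = z * (z * Λ ((X ^ 2 - 1) * B * q) - Λ (X * A * q)) := by
      rw [← map_C_mul_real, show C α * (1 * P0 * q) = (C α * P0) * q by ring, ha,
        show (C (z ^ 2) * ((X ^ 2 - 1) * B) - C z * (X * A)) * q =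
          C (z ^ 2) * ((X ^ 2 - 1) * B * q) - C z * (X * A * q) by ring, map_sub,
        map_C_mul_real, map_C_mul_real]
      ring
    rw [ho0 q hq, mul_zero] at h1
    linarith [(mul_eq_zero.mp h1.symm).resolve_left hz0.ne']
  have hob : ∀ q : ℝ[X], q.degree < n →
      z * Λ ((X ^ 2 - 1) * A * q) = (z ^ 2 - 1) * Λ ((X ^ 2 - 1) * X * B * q) := by
    intro q hq
    have h1 : β * Λ ((X ^ 2 - 1) * P1 * q) =
        z * (z * Λ ((X ^ 2 - 1) * A * q) - (z ^ 2 - 1) * Λ ((X ^ 2 - 1) * X * B * q)) := by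
      rw [← map_C_mul_real, show C β * ((X ^ 2 - 1) * P1 * q) = (X ^ 2 - 1) * (C β * P1) * q by
        ring, hb, show (X ^ 2 - 1) * (C (z ^ 2) * A - C (z * (z ^ 2 - 1)) * (X * B)) * q =
          C (z ^ 2) * ((X ^ 2 - 1) * A * q)
          - C (z * (z ^ 2 - 1)) * ((X ^ 2 - 1) * X * B * q) by ring, map_sub,
        map_C_mul_real, map_C_mul_real]
      ring
    rw [ho1 q hq, mul_zero] at h1
    linarith [(mul_eq_zero.mp h1.symm).resolve_left hz0.ne']
  -- the positive energy
  have hJ1 := hoa A hAd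
  have hJ2 := hob B hBd
  rw [show (X ^ 2 - 1) * A * B = (X ^ 2 - 1) * B * A by ring] at hJ2
  have hJ : 0 < Λ (X * A * A) := by
    by_cases hA : A = 0
    · exfalso
      have hB : B = 0 := by
        by_contra hB
        have h1 : 0 < Λ ((X ^ 2 - 1) * X * B * B) := by
          refine hΛ _ (mul_ne_zero (mul_ne_zero (mul_ne_zero X_sq_sub_one_ne_zero X_ne_zero) hB)
            hB) fun x hx => ?_
          have := mul_nonneg (mul_nonneg (eval_X_sq_sub_one_nonneg x hx)
            (by linarith : (0 : ℝ) ≤ x)) (mul_self_nonneg (B.eval x))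
          simp only [eval_mul, eval_X] at this ⊢
          linarith
        rw [hA] at hJ2
        simp only [mul_zero, map_zero] at hJ2
        exact (mul_pos hσ h1).ne hJ2
      rw [hA, hB] at ha
      simp only [mul_zero, sub_zero, mul_eq_zero, C_eq_zero] at ha
      exact ha.elim hα0 hP0
    · refine hΛ _ (mul_ne_zero (mul_ne_zero X_ne_zero hA) hA) fun x hx => ?_
      have := mul_nonneg (by linarith : (0 : ℝ) ≤ x) (mul_self_nonneg (A.eval x))
      simp only [eval_mul, eval_X]
      linarith
  -- the variation of the image
  have hdae : ∀ x, α * (derivative P0).eval x = z ^ 2 * (2 * x * B.eval x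
      + (x ^ 2 - 1) * (derivative B).eval x) - z * (A.eval x + x * (derivative A).eval x) := by
    intro x
    have := congrArg (fun p => eval x (derivative p)) ha
    simp only [derivative_mul, derivative_C, derivative_sub, derivative_X, derivative_X_pow,
      derivative_one, eval_mul, eval_sub, eval_add, eval_C, eval_X, eval_pow, eval_one,
      eval_zero] at this
    norm_num at this
    linarith
  have hdbe : ∀ x, β * (derivative P1).eval x = z ^ 2 * (derivative A).eval x
      - z * (z ^ 2 - 1) * (B.eval x + x * (derivative B).eval x) := by
    intro x
    have := congrArg (fun p => eval x (derivative p)) hb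
    simp only [derivative_mul, derivative_C, derivative_sub, derivative_X,
      eval_mul, eval_sub, eval_add, eval_C, eval_X, eval_one, eval_zero] at this
    norm_num at this
    linarith
  obtain ⟨e, he⟩ : ∃ e, e = C α' * P0 + C α * R0
      - C d * (C (2 * z) * ((X ^ 2 - 1) * B) - X * A) := ⟨_, rfl⟩
  obtain ⟨h, hh⟩ : ∃ h, h = C β' * P1 + C β * R1
      - C d * (C (2 * z) * A - C (3 * z ^ 2 - 1) * (X * B)) := ⟨_, rfl⟩
  have hed : e.natDegree ≤ n + 1 := by
    rw [natDegree_le_iff_coeff_eq_zero]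
    intro k hk
    obtain ⟨k, rfl⟩ : ∃ j, k = j + 2 := ⟨k - 2, by omega⟩
    rw [degree_lt_iff_coeff_zero] at hAd hBd
    simp only [he, coeff_sub, coeff_add, coeff_C_mul, sub_mul, one_mul, coeff_X_pow_mul]
    rw [coeff_X_mul, hAd _ (by omega), hBd _ (by omega), hBd _ (by omega),
      coeff_eq_zero_of_natDegree_lt (show P0.natDegree < k + 2 by omega),
      coeff_eq_zero_of_natDegree_lt (show R0.natDegree < k + 2 by omega)]
    ring
  have hhd : h.natDegree ≤ n := by
    rw [natDegree_le_iff_coeff_eq_zero]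
    intro k hk
    obtain ⟨k, rfl⟩ : ∃ j, k = j + 1 := ⟨k - 1, by omega⟩
    rw [degree_lt_iff_coeff_zero] at hAd hBd
    simp only [hh, coeff_sub, coeff_add, coeff_C_mul]
    rw [coeff_X_mul, hAd _ (by omega), hBd _ (by omega),
      coeff_eq_zero_of_natDegree_lt (show P1.natDegree < k + 1 by omega),
      coeff_eq_zero_of_natDegree_lt (show R1.natDegree < k + 1 by omega)]
    ring
  obtain ⟨A', B', hAd', hBd', he', hh', -, -⟩ := exists_division (e := e) (h := h) hz hed hhd
    (by
      have h1 := hdae z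
      have h2 := hdbe z
      simp only [he, hh, eval_sub, eval_add, eval_mul, eval_C, eval_X, eval_pow, eval_one]
      linear_combination hd - d * h1 - d * h2)
    (by
      have h1 := hdae (-z)
      have h2 := hdbe (-z)
      simp only [he, hh, eval_sub, eval_add, eval_mul, eval_C, eval_X, eval_pow, eval_one]
      rw [← hα, ← hβ]
      linear_combination β * hα' - α * hβ' + d * h1 - d * h2)
  -- evaluate the variation in two ways
  have hV1 : Λ (1 * (C α' * P0 + C α * R0) * A)
      = Λ (X * (1 * (C α * P0) * A)) := by
    rw [show 1 * (C α' * P0 + C α * R0) * A = C α' * (1 * P0 * A) + C α * (1 * R0 * A) by ring,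
      map_add, map_C_mul_real, map_C_mul_real, ho0 A hAd, hR0 A hAd,
      show X * (1 * (C α * P0) * A) = C α * (X * (1 * P0 * A)) by ring, map_C_mul_real]
    ring
  have hV2 : Λ ((X ^ 2 - 1) * (C β' * P1 + C β * R1) * B)
      = Λ (X * ((X ^ 2 - 1) * (C β * P1) * B)) := by
    rw [show (X ^ 2 - 1) * (C β' * P1 + C β * R1) * B =
        C β' * ((X ^ 2 - 1) * P1 * B) + C β * ((X ^ 2 - 1) * R1 * B) by ring,
      map_add, map_C_mul_real, map_C_mul_real, ho1 B hBd, hR1 B hBd,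
      show X * ((X ^ 2 - 1) * (C β * P1) * B) = C β * (X * ((X ^ 2 - 1) * P1 * B)) by ring,
      map_C_mul_real]
    ring
  have hW : Λ (1 * (C α' * P0 + C α * R0) * A) + Λ ((X ^ 2 - 1) * (C β' * P1 + C β * R1) * B) =
      d * (4 * z * Λ ((X ^ 2 - 1) * B * A) - Λ (X * A * A)
        - (3 * z ^ 2 - 1) * Λ ((X ^ 2 - 1) * X * B * B)) := by
    have h1 : C α' * P0 + C α * R0 = C (z ^ 2) * ((X ^ 2 - 1) * B') - C z * (X * A')
        + C d * (C (2 * z) * ((X ^ 2 - 1) * B) - X * A) := by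
      rw [← he', he]; ring
    have h2 : C β' * P1 + C β * R1 = C (z ^ 2) * A' - C (z * (z ^ 2 - 1)) * (X * B')
        + C d * (C (2 * z) * A - C (3 * z ^ 2 - 1) * (X * B)) := by
      rw [← hh', hh]; ring
    rw [h1, h2, ← map_add]
    have h3 : 1 * (C (z ^ 2) * ((X ^ 2 - 1) * B') - C z * (X * A')
          + C d * (C (2 * z) * ((X ^ 2 - 1) * B) - X * A)) * A
        + (X ^ 2 - 1) * (C (z ^ 2) * A' - C (z * (z ^ 2 - 1)) * (X * B')
          + C d * (C (2 * z) * A - C (3 * z ^ 2 - 1) * (X * B))) * B =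
        C (z ^ 2) * ((X ^ 2 - 1) * A * B') - C z * (X * A * A')
        + C (z ^ 2) * ((X ^ 2 - 1) * B * A')
        - C (z * (z ^ 2 - 1)) * ((X ^ 2 - 1) * X * B * B')
        + C d * (C (2 * z) * ((X ^ 2 - 1) * B * A) + C (2 * z) * ((X ^ 2 - 1) * B * A) - X * A * A
          - C (3 * z ^ 2 - 1) * ((X ^ 2 - 1) * X * B * B)) := by ring
    rw [h3]
    simp only [map_add Λ, map_sub Λ, map_C_mul_real Λ]
    linear_combination z * hoa A' hAd' + z * hob B' hBd'
  have hS1 : P0.leadingCoeff * Λ (X * (1 * (C α * P0) * A)) =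
      α * A.coeff n * Λ (1 * P0 * P0) := by
    have h1 := leadingCoeff_mul_orthogonal (q := X * A) hd0 ho0 (by
      have := degree_mul_left_lt (p := X) (k := 1) natDegree_X_le hAd
      rwa [add_comm 1] at this)
    rw [coeff_X_mul] at h1
    rw [show X * (1 * (C α * P0) * A) = C α * (1 * P0 * (X * A)) by ring, map_C_mul_real]
    linear_combination α * h1
  have hS2 : P1.leadingCoeff * Λ (X * ((X ^ 2 - 1) * (C β * P1) * B)) =
      β * B.coeff (n - 1) * Λ (1 * P0 * P0) := by
    have h1 := leadingCoeff_mul_orthogonal (q := X * B) hd1 ho1 (by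
      have := degree_mul_left_lt (p := X) (k := 1) natDegree_X_le hBd
      rwa [add_comm 1] at this)
    have h2 : (X * B).coeff (n - 1 + 1) = B.coeff (n - 1) := coeff_X_mul B (n - 1)
    rw [Nat.sub_add_cancel hn] at h2
    rw [h2] at h1
    rw [show X * ((X ^ 2 - 1) * (C β * P1) * B) = C β * ((X ^ 2 - 1) * P1 * (X * B)) by ring,
      map_C_mul_real, hK]
    linear_combination β * h1
  have hKpos : 0 < Λ (1 * P0 * P0) := by
    refine hΛ _ (by simpa using hP0) fun x _ => ?_
    simp only [eval_mul, one_mul]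
    exact mul_self_nonneg _
  rw [hV1, hV2] at hW
  generalize Λ (X * (1 * (C α * P0) * A)) = S₁ at hW hS1
  generalize Λ (X * ((X ^ 2 - 1) * (C β * P1) * B)) = S₂ at hW hS2
  generalize Λ (1 * P0 * P0) = K at hS1 hS2 hKpos
  generalize Λ (X * A * A) = J at *
  generalize Λ ((X ^ 2 - 1) * B * A) = M at *
  generalize Λ ((X ^ 2 - 1) * X * B * B) = J' at *
  have hfin1 : (z ^ 2 - 1) * (S₁ + S₂) = -(2 * J) * d := by
    rw [hW]
    linear_combination (d * (4 * (z ^ 2 - 1) - (3 * z ^ 2 - 1))) * hJ1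
      + (d * (3 * z ^ 2 - 1)) * hJ2
  have hfin2 : z * P0.leadingCoeff * P1.leadingCoeff * (S₁ + S₂) =
      K * (P0.leadingCoeff * P1.leadingCoeff * ((z ^ 2 - 1) * α ^ 2 + β ^ 2)
        + z * (α * β) * (P1.leadingCoeff ^ 2 + P0.leadingCoeff ^ 2)) := by
    linear_combination (z * P1.leadingCoeff) * hS1 + (z * P0.leadingCoeff) * hS2
      + (P1.leadingCoeff * α * K) * hAc + (P0.leadingCoeff * β * K) * hBc
  have hSpos : 0 < S₁ + S₂ := by
    have h1 := mul_pos hKpos hquad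
    rw [← hfin2] at h1
    exact (pos_iff_pos_of_mul_pos h1).mp (by positivity)
  have h2 := mul_pos hσ hSpos
  rw [hfin1] at h2
  by_contra! hcon
  nlinarith [mul_nonneg hJ.le hcon]

/-- The weight `(x² - 1)^(-1/2) exp(-ζ x)` without its normalization. -/
noncomputable def baseWeight (ζ x : ℝ) : ℝ :=
  (x ^ 2 - 1) ^ (-(1 / 2) : ℝ) * Real.exp (-ζ * x)

theorem baseWeight_pos (ζ : ℝ) {x : ℝ} (hx : 1 < x) : 0 < baseWeight ζ x :=
  mul_pos (Real.rpow_pos_of_pos (by nlinarith) _) (Real.exp_pos _)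

theorem measurable_baseWeight (ζ : ℝ) : Measurable (baseWeight ζ) := by
  unfold baseWeight; fun_prop

theorem integrableOn_pow_mul_baseWeight {ζ : ℝ} (hζ : 0 < ζ) (k : ℕ) :
    IntegrableOn (fun x => x ^ k * baseWeight ζ x) (Set.Ioi 1) := by
  have h1 : IntegrableOn (fun x : ℝ => x ^ (-(1 / 2) : ℝ) * Real.exp (-(ζ / 2) * x ^ (1 : ℝ)))
      (Set.Ioi 0) :=
    integrableOn_rpow_mul_exp_neg_mul_rpow (by norm_num) one_pos (by positivity)
  have h2 := ((measurePreserving_sub_right volume (1 : ℝ)).integrableOn_comp_preimage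
    (MeasurableEquiv.subRight (1 : ℝ)).measurableEmbedding).mpr h1
  have h3 : (fun x : ℝ => x - 1) ⁻¹' Set.Ioi 0 = Set.Ioi 1 := by ext x; simp
  rw [h3] at h2
  refine Integrable.mono' (h2.const_mul (k.factorial / (ζ / 2) ^ k))
    ((measurable_id.pow_const k).mul (measurable_baseWeight ζ)).aestronglyMeasurable ?_
  filter_upwards [ae_restrict_mem measurableSet_Ioi] with x hx
  have hx : 1 < x := hx
  have hx0 : 0 < x - 1 := by linarith
  have hw := baseWeight_pos ζ hx
  rw [Real.norm_of_nonneg (by positivity)]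
  have h4 := Real.pow_div_factorial_le_exp (ζ / 2 * x) (by positivity) k
  have h5 : x ^ k ≤ k.factorial / (ζ / 2) ^ k * Real.exp (ζ / 2 * x) := by
    rw [mul_pow, div_le_iff₀ (by positivity)] at h4
    rw [div_mul_eq_mul_div, le_div_iff₀ (by positivity)]
    linarith
  have h6 : (x ^ 2 - 1) ^ (-(1 / 2) : ℝ) ≤ (x - 1) ^ (-(1 / 2) : ℝ) :=
    Real.rpow_le_rpow_of_nonpos hx0 (by nlinarith) (by norm_num)
  have h7 : Real.exp (ζ / 2 * x) * Real.exp (-ζ * x) ≤ Real.exp (-(ζ / 2) * (x - 1)) := by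
    rw [← Real.exp_add]
    exact Real.exp_le_exp.mpr (by nlinarith)
  simp only [Function.comp_apply, Real.rpow_one, baseWeight]
  calc x ^ k * ((x ^ 2 - 1) ^ (-(1 / 2) : ℝ) * Real.exp (-ζ * x))
      ≤ (k.factorial / (ζ / 2) ^ k * Real.exp (ζ / 2 * x)) *
          ((x - 1) ^ (-(1 / 2) : ℝ) * Real.exp (-ζ * x)) := by
        gcongr
    _ = k.factorial / (ζ / 2) ^ k * ((x - 1) ^ (-(1 / 2) : ℝ) *
          (Real.exp (ζ / 2 * x) * Real.exp (-ζ * x))) := by ring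
    _ ≤ _ := by gcongr

theorem integrableOn_eval_mul_baseWeight {ζ : ℝ} (hζ : 0 < ζ) (p : ℝ[X]) :
    IntegrableOn (fun x => p.eval x * baseWeight ζ x) (Set.Ioi 1) := by
  have h : (fun x => p.eval x * baseWeight ζ x) =
      fun x => ∑ k ∈ Finset.range (p.natDegree + 1), p.coeff k * (x ^ k * baseWeight ζ x) := by
    funext x
    rw [eval_eq_sum_range, Finset.sum_mul]
    exact Finset.sum_congr rfl fun k _ => by ring
  rw [h]
  exact integrable_finsetSum _ fun k _ => (integrableOn_pow_mul_baseWeight hζ k).const_mul _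

open Classical in
/-- Integration of polynomials against `baseWeight ζ` (for `ζ > 0`). -/
noncomputable def moment (ζ : ℝ) : ℝ[X] →ₗ[ℝ] ℝ :=
  if hζ : 0 < ζ then
    { toFun := fun p => ∫ x in Set.Ioi (1 : ℝ), p.eval x * baseWeight ζ x
      map_add' := fun p q => by
        rw [← integral_add (integrableOn_eval_mul_baseWeight hζ p)
          (integrableOn_eval_mul_baseWeight hζ q)]
        simp only [eval_add, add_mul]
      map_smul' := fun c p => by
        rw [RingHom.id_apply, smul_eq_mul, ← integral_const_mul]
        simp only [eval_smul, smul_eq_mul, mul_assoc] }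
  else 0

theorem moment_apply {ζ : ℝ} (hζ : 0 < ζ) (p : ℝ[X]) :
    moment ζ p = ∫ x in Set.Ioi (1 : ℝ), p.eval x * baseWeight ζ x := by
  simp [moment, hζ]

theorem posOnIoi_moment {ζ : ℝ} (hζ : 0 < ζ) : PosOnIoi (moment ζ) := by
  intro p hp hnn
  rw [moment_apply hζ, setIntegral_pos_iff_support_of_nonneg_ae _
    (integrableOn_eval_mul_baseWeight hζ p)]
  · have h1 : Set.Ioi (1 : ℝ) \ (p.roots.toFinset : Set ℝ) ⊆
        Function.support (fun x => p.eval x * baseWeight ζ x) ∩ Set.Ioi 1 := by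
      rintro x ⟨hx, hx2⟩
      refine ⟨mul_ne_zero (fun h => hx2 ?_) (baseWeight_pos ζ hx).ne', hx⟩
      simp [hp, h]
    refine lt_of_lt_of_le ?_ (measure_mono h1)
    rw [measure_sdiff_null (Finset.measure_zero _ _)]
    simp
  · filter_upwards [ae_restrict_mem measurableSet_Ioi] with x hx
    exact mul_nonneg (hnn x hx) (baseWeight_pos ζ hx).le

theorem hasDerivAt_moment {ζ : ℝ} (hζ : 0 < ζ) (p : ℝ[X]) :
    HasDerivAt (fun t => moment t p) (-moment ζ (X * p)) ζ := by
  have h1 := hasDerivAt_integral_of_dominated_loc_of_deriv_le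
    (μ := volume.restrict (Set.Ioi (1 : ℝ))) (s := Set.Ioi (ζ / 2))
    (F := fun t x => p.eval x * baseWeight t x)
    (F' := fun t x => -((X * p).eval x * baseWeight t x))
    (bound := fun x => ‖(X * p).eval x * baseWeight (ζ / 2) x‖) (x₀ := ζ)
    (Ioi_mem_nhds (by linarith))
    (Filter.Eventually.of_forall fun t =>
      (p.continuous.measurable.mul (measurable_baseWeight t)).aestronglyMeasurable)
    (integrableOn_eval_mul_baseWeight hζ p)
    (integrableOn_eval_mul_baseWeight hζ (X * p)).neg.aestronglyMeasurable
    (by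
      filter_upwards [ae_restrict_mem measurableSet_Ioi] with x hx t ht
      have hx : 1 < x := hx
      have ht : ζ / 2 < t := ht
      rw [norm_neg, norm_mul, norm_mul]
      refine mul_le_mul_of_nonneg_left ?_ (norm_nonneg _)
      rw [Real.norm_of_nonneg (baseWeight_pos _ hx).le,
        Real.norm_of_nonneg (baseWeight_pos _ hx).le]
      refine mul_le_mul_of_nonneg_left (Real.exp_le_exp.mpr (by nlinarith)) ?_
      exact Real.rpow_nonneg (by nlinarith) _)
    (integrableOn_eval_mul_baseWeight (half_pos hζ) (X * p)).norm
    (Filter.Eventually.of_forall fun x t _ => by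
      unfold baseWeight
      have h2 : HasDerivAt (fun t : ℝ => Real.exp (-t * x)) (Real.exp (-t * x) * (-1 * x)) t :=
        ((hasDerivAt_id t).neg.mul_const x).exp
      refine ((h2.const_mul ((x ^ 2 - 1) ^ (-(1 / 2) : ℝ))).const_mul (p.eval x)).congr_deriv ?_
      rw [eval_mul, eval_X]
      ring)
  have h3 := h1.2
  rw [integral_neg, ← moment_apply hζ] at h3
  refine h3.congr_of_eventuallyEq ?_
  filter_upwards [Ioi_mem_nhds hζ] with t ht
  exact moment_apply ht p

theorem eval_eq_sum_range_of_le {p : ℝ[X]} {N : ℕ} (hp : p.natDegree ≤ N) (x : ℝ) :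
    p.eval x = ∑ k ∈ Finset.range (N + 1), p.coeff k * x ^ k :=
  eval_eq_sum_range' (Nat.lt_succ_of_le hp) x

/-- The polynomial whose coefficients are the derivatives of those of a family `p`. -/
noncomputable def coeffDeriv (p : ℝ → ℝ[X]) (N : ℕ) (ζ : ℝ) : ℝ[X] :=
  ∑ k ∈ Finset.range (N + 1), C (deriv (fun t => (p t).coeff k) ζ) * X ^ k

theorem natDegree_coeffDeriv_le (p : ℝ → ℝ[X]) (N : ℕ) (ζ : ℝ) :
    (coeffDeriv p N ζ).natDegree ≤ N :=
  natDegree_sum_le_of_forall_le _ _ fun k hk =>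
    (natDegree_C_mul_X_pow_le _ _).trans (by simpa [Nat.lt_succ_iff] using hk)

section

variable {p : ℝ → ℝ[X]} {N : ℕ} {ζ : ℝ}

theorem hasDerivAt_eval_family (hζ : 0 < ζ) (hN : ∀ t, 0 < t → (p t).natDegree ≤ N)
    (hp : ∀ k, DifferentiableOn ℝ (fun t => (p t).coeff k) (Set.Ioi 0))
    {y : ℝ → ℝ} {y' : ℝ} (hy : HasDerivAt y y' ζ) :
    HasDerivAt (fun t => (p t).eval (y t))
      ((coeffDeriv p N ζ).eval (y ζ) + y' * (derivative (p ζ)).eval (y ζ)) ζ := by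
  have hk : ∀ k, HasDerivAt (fun t => (p t).coeff k) (deriv (fun t => (p t).coeff k) ζ) ζ :=
    fun k => ((hp k).differentiableAt (Ioi_mem_nhds hζ)).hasDerivAt
  have h1 : HasDerivAt (fun t => ∑ k ∈ Finset.range (N + 1), (p t).coeff k * y t ^ k)
      (∑ k ∈ Finset.range (N + 1), (deriv (fun t => (p t).coeff k) ζ * y ζ ^ k +
        (p ζ).coeff k * (k * y ζ ^ (k - 1) * y'))) ζ :=
    HasDerivAt.fun_sum fun k _ => (hk k).mul (hy.pow k)
  refine (h1.congr_deriv ?_).congr_of_eventuallyEq ?_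
  · rw [Finset.sum_add_distrib, coeffDeriv, eval_finsetSum]
    congr 1
    · simp
    · conv_rhs => rw [(p ζ).as_sum_range' (N + 1) (Nat.lt_succ_of_le (hN ζ hζ))]
      rw [derivative_sum, eval_finsetSum, Finset.mul_sum]
      refine Finset.sum_congr rfl fun k _ => ?_
      rw [derivative_monomial, eval_monomial]
      ring
  · filter_upwards [Ioi_mem_nhds hζ] with t ht
    exact eval_eq_sum_range_of_le (hN t ht) _

theorem hasDerivAt_moment_family (hζ : 0 < ζ) (hN : ∀ t, 0 < t → (p t).natDegree ≤ N)
    (hp : ∀ k, DifferentiableOn ℝ (fun t => (p t).coeff k) (Set.Ioi 0)) (q : ℝ[X]) :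
    HasDerivAt (fun t => moment t (p t * q))
      (moment ζ (coeffDeriv p N ζ * q) - moment ζ (X * (p ζ * q))) ζ := by
  have hk : ∀ k, HasDerivAt (fun t => (p t).coeff k) (deriv (fun t => (p t).coeff k) ζ) ζ :=
    fun k => ((hp k).differentiableAt (Ioi_mem_nhds hζ)).hasDerivAt
  have hexp : ∀ t, 0 < t → p t * q =
      ∑ k ∈ Finset.range (N + 1), C ((p t).coeff k) * (X ^ k * q) := by
    intro t ht
    conv_lhs => rw [(p t).as_sum_range_C_mul_X_pow' (Nat.lt_succ_of_le (hN t ht))]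
    rw [Finset.sum_mul]
    exact Finset.sum_congr rfl fun k _ => by ring
  have h1 : HasDerivAt (fun t => ∑ k ∈ Finset.range (N + 1),
        (p t).coeff k * moment t (X ^ k * q))
      (∑ k ∈ Finset.range (N + 1), (deriv (fun t => (p t).coeff k) ζ * moment ζ (X ^ k * q) +
        (p ζ).coeff k * -moment ζ (X * (X ^ k * q)))) ζ :=
    HasDerivAt.fun_sum fun k _ => (hk k).mul (hasDerivAt_moment hζ _)
  refine (h1.congr_deriv ?_).congr_of_eventuallyEq ?_
  · rw [Finset.sum_add_distrib, coeffDeriv, sub_eq_add_neg]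
    congr 1
    · rw [Finset.sum_mul, map_sum]
      refine Finset.sum_congr rfl fun k _ => ?_
      rw [mul_assoc, map_C_mul_real]
    · rw [hexp ζ hζ, Finset.mul_sum, map_sum, ← Finset.sum_neg_distrib]
      refine Finset.sum_congr rfl fun k _ => ?_
      rw [show X * (C ((p ζ).coeff k) * (X ^ k * q)) =
        C ((p ζ).coeff k) * (X * (X ^ k * q)) by ring, map_C_mul_real]
      ring
  · filter_upwards [Ioi_mem_nhds hζ] with t ht
    simp only [hexp t ht, map_sum, map_C_mul_real]

/-- Differentiating an orthogonality relation with respect to the parameter. -/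
theorem moment_coeffDeriv_of_orthogonal (hζ : 0 < ζ) (hN : ∀ t, 0 < t → (p t).natDegree ≤ N)
    (hp : ∀ k, DifferentiableOn ℝ (fun t => (p t).coeff k) (Set.Ioi 0)) {v q : ℝ[X]}
    (horth : ∀ t, 0 < t → moment t (v * p t * q) = 0) :
    moment ζ (v * coeffDeriv p N ζ * q) = moment ζ (X * (v * p ζ * q)) := by
  have h1 := hasDerivAt_moment_family hζ hN hp (v * q)
  have h2 : HasDerivAt (fun t => moment t (p t * (v * q))) 0 ζ := by
    refine (hasDerivAt_const ζ (0 : ℝ)).congr_of_eventuallyEq ?_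
    filter_upwards [Ioi_mem_nhds hζ] with t ht
    rw [← horth t ht]
    congr 1
    ring
  have h3 := sub_eq_zero.mp (h1.unique h2)
  rw [show v * coeffDeriv p N ζ * q = coeffDeriv p N ζ * (v * q) by ring, h3]
  congr 1
  ring

end

theorem wgt_zero_eq (ζ x : ℝ) : wgt 0 ζ x = baseWeight ζ x / besselK 1 ζ := by
  rw [wgt, baseWeight]
  norm_num

theorem wgt_one_eq (ζ : ℝ) {x : ℝ} (hx : 1 < x) :
    wgt 1 ζ x = (x ^ 2 - 1) * baseWeight ζ x / besselK 1 ζ := by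
  have h0 : 0 < x ^ 2 - 1 := by nlinarith
  rw [wgt, baseWeight, ← mul_assoc]
  congr 2
  rw [Nat.cast_one, show (1 : ℝ) - 1 / 2 = 1 + -(1 / 2) by ring, Real.rpow_add h0, Real.rpow_one]

theorem integral_wgt_zero {ζ : ℝ} (hζ : 0 < ζ) (p q : ℝ[X]) :
    ∫ x in Set.Ioi (1 : ℝ), p.eval x * q.eval x * wgt 0 ζ x =
      moment ζ (1 * p * q) / besselK 1 ζ := by
  rw [moment_apply hζ, ← integral_div]
  refine integral_congr_ae (Filter.Eventually.of_forall fun x => ?_)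
  simp only [wgt_zero_eq, one_mul, eval_mul]
  ring

theorem integral_wgt_one {ζ : ℝ} (hζ : 0 < ζ) (p q : ℝ[X]) :
    ∫ x in Set.Ioi (1 : ℝ), p.eval x * q.eval x * wgt 1 ζ x =
      moment ζ ((X ^ 2 - 1) * p * q) / besselK 1 ζ := by
  rw [moment_apply hζ, ← integral_div]
  refine setIntegral_congr_fun measurableSet_Ioi fun x hx => ?_
  simp only [wgt_one_eq ζ hx, eval_mul, eval_sub, eval_pow, eval_X, eval_one]
  ring

theorem stmt16
    (P0 P1 : ℝ → ℕ → Polynomial ℝ) (lc0 lc1 : ℝ → ℕ → ℝ)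
    (hdeg0 : ∀ ζ : ℝ, 0 < ζ → ∀ n, (P0 ζ n).natDegree = n)
    (hdeg1 : ∀ ζ : ℝ, 0 < ζ → ∀ n, (P1 ζ n).natDegree = n)
    (hlc0 : ∀ ζ : ℝ, 0 < ζ → ∀ n, (P0 ζ n).leadingCoeff = lc0 ζ n)
    (hlc1 : ∀ ζ : ℝ, 0 < ζ → ∀ n, (P1 ζ n).leadingCoeff = lc1 ζ n)
    (hlc0pos : ∀ ζ : ℝ, 0 < ζ → ∀ n, 0 < lc0 ζ n)
    (hlc1pos : ∀ ζ : ℝ, 0 < ζ → ∀ n, 0 < lc1 ζ n)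
    (horth0 : ∀ ζ : ℝ, 0 < ζ → ∀ m n, (∫ x in Set.Ioi (1 : ℝ),
        (P0 ζ m).eval x * (P0 ζ n).eval x * wgt 0 ζ x) = if m = n then (1 : ℝ) else 0)
    (horth1 : ∀ ζ : ℝ, 0 < ζ → ∀ m n, (∫ x in Set.Ioi (1 : ℝ),
        (P1 ζ m).eval x * (P1 ζ n).eval x * wgt 1 ζ x) = if m = n then (1 : ℝ) else 0)
    (hcoeff0 : ∀ n k, DifferentiableOn ℝ (fun ζ => (P0 ζ n).coeff k) (Set.Ioi 0))
    (hcoeff1 : ∀ n k, DifferentiableOn ℝ (fun ζ => (P1 ζ n).coeff k) (Set.Ioi 0))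
    (n : ℕ) (hn : 1 ≤ n)
    (Q : ℝ → Polynomial ℝ)
    (hQ : ∀ ζ : ℝ, Q ζ =
      P0 ζ (n + 1) * (P1 ζ n).comp (-X) + (P0 ζ (n + 1)).comp (-X) * P1 ζ n)
    (zq : ℝ → ℕ → ℝ)
    (hzqgt : ∀ ζ : ℝ, 0 < ζ → ∀ i, 1 ≤ i → i ≤ n → 1 < zq ζ i)
    (hzqmono : ∀ ζ : ℝ, 0 < ζ → ∀ i j, 1 ≤ i → i < j → j ≤ n → zq ζ i < zq ζ j)
    (hzqfac : ∀ ζ : ℝ, 0 < ζ → Q ζ = C ((Q ζ).leadingCoeff) *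
        ∏ i ∈ Finset.Icc 1 n, ((X - C (zq ζ i)) * (X + C (zq ζ i))))
    (hzqdiff : ∀ i, 1 ≤ i → i ≤ n → DifferentiableOn ℝ (fun ζ => zq ζ i) (Set.Ioi 0)) :
    ∀ i, 1 ≤ i → i ≤ n →
      (∀ ζ : ℝ, 0 < ζ → deriv (fun t => zq t i) ζ < 0) ∧
      StrictAntiOn (fun ζ => zq ζ i) (Set.Ioi 0) ∧
      StrictMonoOn (fun ζ => -zq ζ i) (Set.Ioi 0) := by
  intro i hi1 hin
  have hlcP0 : ∀ ζ, 0 < ζ → ∀ m, 0 < (P0 ζ m).leadingCoeff := fun ζ hζ m => by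
    rw [hlc0 ζ hζ]; exact hlc0pos ζ hζ m
  have hlcP1 : ∀ ζ, 0 < ζ → ∀ m, 0 < (P1 ζ m).leadingCoeff := fun ζ hζ m => by
    rw [hlc1 ζ hζ]; exact hlc1pos ζ hζ m
  have hm0 : ∀ ζ, 0 < ζ → ∀ m k, moment ζ (1 * P0 ζ m * P0 ζ k) / besselK 1 ζ =
      if m = k then (1 : ℝ) else 0 := fun ζ hζ m k => by
    rw [← integral_wgt_zero hζ]; exact horth0 ζ hζ m k
  have hm1 : ∀ ζ, 0 < ζ → ∀ m k, moment ζ ((X ^ 2 - 1) * P1 ζ m * P1 ζ k) / besselK 1 ζ =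
      if m = k then (1 : ℝ) else 0 := fun ζ hζ m k => by
    rw [← integral_wgt_one hζ]; exact horth1 ζ hζ m k
  have hK : ∀ ζ, 0 < ζ → besselK 1 ζ ≠ 0 := fun ζ hζ h => by
    have := hm0 ζ hζ 0 0
    simp [h] at this
  have ho0 : ∀ ζ, 0 < ζ → ∀ q : ℝ[X], q.degree < (n + 1 : ℕ) →
      moment ζ (1 * P0 ζ (n + 1) * q) = 0 := fun ζ hζ q hq =>
    orthogonal_of_degree_lt (hdeg0 ζ hζ)
      (fun m => leadingCoeff_ne_zero.mp (hlcP0 ζ hζ m).ne')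
      (fun m k hmk => by
        have := hm0 ζ hζ m k
        rw [if_neg hmk, div_eq_zero_iff] at this
        exact this.resolve_right (hK ζ hζ)) _ hq
  have ho1 : ∀ ζ, 0 < ζ → ∀ q : ℝ[X], q.degree < n →
      moment ζ ((X ^ 2 - 1) * P1 ζ n * q) = 0 := fun ζ hζ q hq =>
    orthogonal_of_degree_lt (hdeg1 ζ hζ)
      (fun m => leadingCoeff_ne_zero.mp (hlcP1 ζ hζ m).ne')
      (fun m k hmk => by
        have := hm1 ζ hζ m k
        rw [if_neg hmk, div_eq_zero_iff] at this
        exact this.resolve_right (hK ζ hζ)) _ hq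
  have hroot : ∀ ζ, 0 < ζ → (P0 ζ (n + 1)).eval (zq ζ i) * (P1 ζ n).eval (-zq ζ i) +
      (P0 ζ (n + 1)).eval (-zq ζ i) * (P1 ζ n).eval (zq ζ i) = 0 := fun ζ hζ => by
    have h1 : (Q ζ).eval (zq ζ i) = 0 := by
      rw [hzqfac ζ hζ, eval_mul, eval_prod,
        Finset.prod_eq_zero (Finset.mem_Icc.mpr ⟨hi1, hin⟩) (by simp), mul_zero]
    rw [hQ] at h1
    simpa using h1
  have hderiv : ∀ ζ : ℝ, 0 < ζ → deriv (fun t => zq t i) ζ < 0 := by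
    intro ζ hζ
    have hz : HasDerivAt (fun t => zq t i) (deriv (fun t => zq t i) ζ) ζ :=
      ((hzqdiff i hi1 hin).differentiableAt (Ioi_mem_nhds hζ)).hasDerivAt
    have hN0 : ∀ t, 0 < t → (P0 t (n + 1)).natDegree ≤ n + 1 := fun t ht => (hdeg0 t ht _).le
    have hN1 : ∀ t, 0 < t → (P1 t n).natDegree ≤ n := fun t ht => (hdeg1 t ht _).le
    have hQ' := ((hasDerivAt_eval_family hζ hN0 (hcoeff0 (n + 1)) hz).mul
      (hasDerivAt_eval_family hζ hN1 (hcoeff1 n) hz.neg)).add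
      ((hasDerivAt_eval_family hζ hN0 (hcoeff0 (n + 1)) hz.neg).mul
      (hasDerivAt_eval_family hζ hN1 (hcoeff1 n) hz))
    have hQ0 := hQ'.unique ((hasDerivAt_const ζ (0 : ℝ)).congr_of_eventuallyEq (by
      filter_upwards [Ioi_mem_nhds hζ] with t ht
      exact hroot t ht))
    refine zero_velocity_neg (posOnIoi_moment hζ) hn (hdeg0 ζ hζ (n + 1)) (hdeg1 ζ hζ n)
      (hlcP0 ζ hζ _) (hlcP1 ζ hζ _) (ho0 ζ hζ) (ho1 ζ hζ) ?_
      (natDegree_coeffDeriv_le (fun t => P0 t (n + 1)) (n + 1) ζ)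
      (natDegree_coeffDeriv_le (fun t => P1 t n) n ζ)
      (fun q hq => moment_coeffDeriv_of_orthogonal hζ hN0 (hcoeff0 (n + 1))
        fun t ht => ho0 t ht q hq)
      (fun q hq => moment_coeffDeriv_of_orthogonal hζ hN1 (hcoeff1 n)
        fun t ht => ho1 t ht q hq)
      (hzqgt ζ hζ i hi1 hin) (hroot ζ hζ) ?_
    · have h0 := hm0 ζ hζ (n + 1) (n + 1)
      have h1 := hm1 ζ hζ n n
      rw [if_pos rfl, div_eq_one_iff_eq (hK ζ hζ)] at h0 h1
      rw [h0, h1]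
    · simp only [Pi.neg_apply] at hQ0
      linear_combination hQ0
  have hanti : StrictAntiOn (fun ζ => zq ζ i) (Set.Ioi 0) := by
    refine strictAntiOn_of_deriv_neg (convex_Ioi 0) (hzqdiff i hi1 hin).continuousOn ?_
    intro ζ hζ
    rw [interior_Ioi] at hζ
    exact hderiv ζ hζ
  exact ⟨hderiv, hanti, hanti.neg⟩
end
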